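/- Let κ ∈ ℝ, r ∈ ℕ, and let f_0, …, f_r : ℍ → ℂ be meromorphic functions. Set F(z) := ∑_{j=0}^r y^{-j} f_j(z) with y = Im z. Then R_κ(F)(z) = ∑_{j=0}^{r+1} y^{-j} g_j(z), where g_0 = 2i f_0', g_j = (κ - j + 1) f_{j-1} + 2i f_j' for 1 ≤ j ≤ r, and g_{r+1} = (κ - r) f_r. In particular, each g_j is meromorphic, and for every l ∈ ℕ the 'meromorphic part' (the y⁰-coefficient) of R_κ^l(F) equals (2i)^l f_0^{(l)}. -/

import Mathlib

open Complex Finset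

noncomputable section

/-- Partial derivative in the real (`x`) direction. -/
def pdx (F : ℂ → ℂ) (z : ℂ) : ℂ := fderiv ℝ F z 1

/-- Partial derivative in the imaginary (`y`) direction. -/
def pdy (F : ℂ → ℂ) (z : ℂ) : ℂ := fderiv ℝ F z Complex.I

/-- Wirtinger derivative `∂/∂z`. -/
def wdz (F : ℂ → ℂ) (z : ℂ) : ℂ := (pdx F z - Complex.I * pdy F z) / 2

/-- The Maass raising operator `R_κ := 2i ∂/∂z + κ/y`. -/
def raiseOp (κ : ℝ) (F : ℂ → ℂ) (z : ℂ) : ℂ :=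
  2 * Complex.I * wdz F z + (κ : ℂ) / z.im * F z

/-- Iterated raising `R_κ^l := R_{κ+2l-2} ∘ ⋯ ∘ R_κ`. -/
def raiseIter : ℕ → ℝ → (ℂ → ℂ) → (ℂ → ℂ)
  | 0, _, F => F
  | l + 1, κ, F => raiseOp (κ + 2 * l) (raiseIter l κ F)

end

/-- The `y^{-j}`-coefficient of `R_κ(∑_{j=0}^r y^{-j} f_j)`. -/
noncomputable def raiseCoeff (κ : ℝ) (r : ℕ) (f : ℕ → ℂ → ℂ) (j : ℕ) (z : ℂ) : ℂ :=
  if j = 0 then 2 * Complex.I * deriv (f 0) z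
  else if j = r + 1 then ((κ : ℂ) - r) * f r z
  else ((κ : ℂ) - j + 1) * f (j - 1) z + 2 * Complex.I * deriv (f j) z

theorem raiseOp_congr {κ : ℝ} {F G : ℂ → ℂ} {z : ℂ} (h : F =ᶠ[nhds z] G) :
    raiseOp κ F z = raiseOp κ G z := by
  simp only [raiseOp, wdz, pdx, pdy, h.fderiv_eq, h.eq_of_nhds]

theorem hasFDerivAt_ofReal_im (z : ℂ) :
    HasFDerivAt (fun w : ℂ => (w.im : ℂ)) (Complex.ofRealCLM.comp Complex.imCLM) z :=
  (Complex.ofRealCLM.comp Complex.imCLM).hasFDerivAt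

theorem hasFDerivAt_im_zpow_mul {g : ℂ → ℂ} {z : ℂ} (hz : 0 < z.im)
    (hg : DifferentiableAt ℂ g z) (n : ℤ) :
    ∃ L : ℂ →L[ℝ] ℂ, HasFDerivAt (fun w : ℂ => (w.im : ℂ) ^ n * g w) L z ∧
      L 1 = (z.im : ℂ) ^ n * deriv g z ∧
      L Complex.I = (z.im : ℂ) ^ n * (deriv g z * Complex.I) +
        n * (z.im : ℂ) ^ (n - 1) * g z := by
  have hy : (z.im : ℂ) ≠ 0 := by exact_mod_cast hz.ne'
  have h1 := ((hasDerivAt_zpow n (z.im : ℂ) (Or.inl hy)).hasFDerivAt.restrictScalars ℝ).comp z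
    (hasFDerivAt_ofReal_im z)
  have h2 := hg.hasDerivAt.hasFDerivAt.restrictScalars ℝ
  refine ⟨_, h1.mul h2, ?_, ?_⟩
  · simp
  · simp
    ring

theorem raiseOp_sum {κ : ℝ} {r : ℕ} {f : ℕ → ℂ → ℂ} {z : ℂ} (hz : 0 < z.im)
    (hf : ∀ j ≤ r, DifferentiableAt ℂ (f j) z) :
    raiseOp κ (fun w => ∑ j ∈ range (r + 1), ((w.im : ℂ)) ^ (-(j : ℤ)) * f j w) z
      = ∑ j ∈ range (r + 2), ((z.im : ℂ)) ^ (-(j : ℤ)) * raiseCoeff κ r f j z := by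
  have hy : (z.im : ℂ) ≠ 0 := by exact_mod_cast hz.ne'
  have key : ∀ j, ∃ L : ℂ →L[ℝ] ℂ, j ∈ range (r + 1) →
      HasFDerivAt (fun w : ℂ => (w.im : ℂ) ^ (-(j : ℤ)) * f j w) L z ∧
      L 1 = (z.im : ℂ) ^ (-(j : ℤ)) * deriv (f j) z ∧
      L Complex.I = (z.im : ℂ) ^ (-(j : ℤ)) * (deriv (f j) z * Complex.I) +
        (-(j : ℤ) : ℤ) * (z.im : ℂ) ^ (-(j : ℤ) - 1) * f j z := by
    intro j
    by_cases hj : j ∈ range (r + 1)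
    · obtain ⟨L, hL⟩ := hasFDerivAt_im_zpow_mul hz
        (hf j (by simpa [Nat.lt_succ_iff] using hj)) (-(j : ℤ))
      exact ⟨L, fun _ => hL⟩
    · exact ⟨0, fun h => absurd h hj⟩
  choose L hL using key
  have hsum := HasFDerivAt.fun_sum (u := range (r + 1)) fun j hj => (hL j hj).1
  have hlhs : raiseOp κ (fun w => ∑ j ∈ range (r + 1), ((w.im : ℂ)) ^ (-(j : ℤ)) * f j w) z
      = ∑ j ∈ range (r + 1), (z.im : ℂ) ^ (-(j : ℤ)) * (2 * Complex.I * deriv (f j) z)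
        + ∑ j ∈ range (r + 1),
          (z.im : ℂ) ^ (-((j + 1 : ℕ) : ℤ)) * (((κ : ℂ) - j) * f j z) := by
    simp only [raiseOp, wdz, pdx, pdy, hsum.fderiv, _root_.sum_apply]
    rw [mul_sum, ← sum_sub_distrib, sum_div, mul_sum, mul_sum, ← sum_add_distrib,
      ← sum_add_distrib]
    refine sum_congr rfl fun j hj => ?_
    have e : (z.im : ℂ) ^ (-((j + 1 : ℕ) : ℤ)) = (z.im : ℂ) ^ (-(j : ℤ)) / z.im := by
      rw [div_eq_mul_inv, ← zpow_sub_one₀ hy]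
      congr 1
      push_cast
      ring
    rw [(hL j hj).2.1, (hL j hj).2.2, zpow_sub_one₀ hy, e]
    generalize (z.im : ℂ) ^ (-(j : ℤ)) = p
    push_cast
    field_simp
    ring_nf
    simp only [Complex.I_sq, Complex.I_pow_three]
    ring
  have hcoeff : ∀ j ∈ range (r + 2), (z.im : ℂ) ^ (-(j : ℤ)) * raiseCoeff κ r f j z
      = (if j = r + 1 then 0 else
          (z.im : ℂ) ^ (-(j : ℤ)) * (2 * Complex.I * deriv (f j) z))
        + (if j = 0 then 0 else
          (z.im : ℂ) ^ (-(j : ℤ)) * (((κ : ℂ) - (j - 1 : ℕ)) * f (j - 1) z)) := by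
    intro j _
    rcases j with _ | j
    · simp [raiseCoeff]
    · by_cases h : j = r
      · subst h
        simp [raiseCoeff]
      · simp [raiseCoeff, h]
        ring
  rw [hlhs, sum_congr rfl hcoeff, sum_add_distrib]
  congr 1
  · rw [sum_range_succ _ (r + 1), if_pos rfl, add_zero]
    exact sum_congr rfl fun j hj => (if_neg (mem_range.mp hj).ne).symm
  · rw [sum_range_succ' _ (r + 1)]
    simp

theorem meromorphicOn_raiseCoeff {κ : ℝ} {r : ℕ} {f : ℕ → ℂ → ℂ} {s : Set ℂ}
    (hf : ∀ j, MeromorphicOn (f j) s) (j : ℕ) : MeromorphicOn (raiseCoeff κ r f j) s := by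
  intro z hz
  have h := fun j => hf j z hz
  have hd := fun j => (h j).deriv
  unfold raiseCoeff
  split_ifs
  · exact (MeromorphicAt.const _ z).fun_mul (hd 0)
  · exact (MeromorphicAt.const _ z).fun_mul (h r)
  · exact ((MeromorphicAt.const _ z).fun_mul (h _)).fun_add
      ((MeromorphicAt.const _ z).fun_mul (hd j))

theorem analyticAt_raiseCoeff {κ : ℝ} {r : ℕ} {f : ℕ → ℂ → ℂ} {z : ℂ}
    (hf : ∀ j ≤ r, AnalyticAt ℂ (f j) z) {j : ℕ} (hj : j ≤ r + 1) :
    AnalyticAt ℂ (raiseCoeff κ r f j) z := by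
  unfold raiseCoeff
  split_ifs
  · exact analyticAt_const.fun_mul (hf 0 r.zero_le).deriv
  · exact analyticAt_const.fun_mul (hf r le_rfl)
  · exact (analyticAt_const.fun_mul (hf _ (by omega))).fun_add
      (analyticAt_const.fun_mul (hf j (by omega)).deriv)

/-- The `y^{-j}`-coefficients of `R_κ^l(∑_{j=0}^r y^{-j} f_j)`. -/
noncomputable def raiseIterCoeff (κ : ℝ) (r : ℕ) (f : ℕ → ℂ → ℂ) : ℕ → ℕ → ℂ → ℂ
  | 0 => f
  | l + 1 => raiseCoeff (κ + 2 * l) (r + l) (raiseIterCoeff κ r f l)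

theorem meromorphicOn_raiseIterCoeff {κ : ℝ} {r : ℕ} {f : ℕ → ℂ → ℂ} {s : Set ℂ}
    (hf : ∀ j, MeromorphicOn (f j) s) (l : ℕ) :
    ∀ j, MeromorphicOn (raiseIterCoeff κ r f l j) s := by
  induction l with
  | zero => exact hf
  | succ l ih => exact meromorphicOn_raiseCoeff ih

theorem analyticAt_raiseIterCoeff {κ : ℝ} {r : ℕ} {f : ℕ → ℂ → ℂ} {z : ℂ}
    (hf : ∀ j ≤ r, AnalyticAt ℂ (f j) z) (l : ℕ) :
    ∀ j ≤ r + l, AnalyticAt ℂ (raiseIterCoeff κ r f l j) z := by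
  induction l with
  | zero => exact hf
  | succ l ih => exact fun j hj => analyticAt_raiseCoeff ih hj

theorem eventually_forall_analyticAt {r : ℕ} {f : ℕ → ℂ → ℂ} {z : ℂ}
    (hf : ∀ j ≤ r, AnalyticAt ℂ (f j) z) :
    ∀ᶠ w in nhds z, ∀ j ≤ r, AnalyticAt ℂ (f j) w :=
  (Set.finite_Iic r).eventually_all.mpr fun j hj => (hf j hj).eventually_analyticAt

theorem raiseIter_sum {κ : ℝ} {r : ℕ} {f : ℕ → ℂ → ℂ} (l : ℕ) {z : ℂ} (hz : 0 < z.im)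
    (hf : ∀ j ≤ r, AnalyticAt ℂ (f j) z) :
    raiseIter l κ (fun w => ∑ j ∈ range (r + 1), ((w.im : ℂ)) ^ (-(j : ℤ)) * f j w) z
      = ∑ j ∈ range (r + l + 1), ((z.im : ℂ)) ^ (-(j : ℤ)) * raiseIterCoeff κ r f l j z := by
  induction l generalizing z with
  | zero => rfl
  | succ l ih =>
    have hnear : ∀ᶠ w : ℂ in nhds z, 0 < w.im :=
      Complex.continuous_im.continuousAt.eventually (lt_mem_nhds hz)
    rw [raiseIter, raiseOp_congr (hnear.and (eventually_forall_analyticAt hf) |>.mono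
      fun w hw => ih hw.1 hw.2)]
    exact raiseOp_sum hz fun j hj => (analyticAt_raiseIterCoeff hf l j hj).differentiableAt

theorem raiseIterCoeff_zero (κ : ℝ) (r : ℕ) (f : ℕ → ℂ → ℂ) (l : ℕ) :
    raiseIterCoeff κ r f l 0 = fun z => (2 * Complex.I) ^ l * iteratedDeriv l (f 0) z := by
  induction l with
  | zero => simp [raiseIterCoeff]
  | succ l ih =>
    ext z
    rw [raiseIterCoeff, raiseCoeff, if_pos rfl, ih, deriv_const_mul_field, iteratedDeriv_succ]
    ring

/-- Raising an almost meromorphic modular form `F = ∑_{j=0}^r y^{-j} f_j`: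
`R_κ(F) = ∑_{j=0}^{r+1} y^{-j} g_j` with `g_0 = 2i f_0'`,
`g_j = (κ-j+1) f_{j-1} + 2i f_j'` for `1 ≤ j ≤ r`, `g_{r+1} = (κ-r) f_r`
(all meromorphic), and the `y⁰`-coefficient of `R_κ^l(F)` is `(2i)^l f_0^{(l)}`. -/
theorem raise_almost_meromorphic (κ : ℝ) (r : ℕ) (f : ℕ → ℂ → ℂ)
    (hf : ∀ j, MeromorphicOn (f j) {z : ℂ | 0 < z.im}) :
    (∀ z : ℂ, 0 < z.im → (∀ j, AnalyticAt ℂ (f j) z) →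
      raiseOp κ (fun w => ∑ j ∈ range (r + 1), ((w.im : ℂ)) ^ (-(j : ℤ)) * f j w) z
        = ∑ j ∈ range (r + 2), ((z.im : ℂ)) ^ (-(j : ℤ)) *
            (if j = 0 then 2 * Complex.I * deriv (f 0) z
             else if j = r + 1 then ((κ : ℂ) - r) * f r z
             else ((κ : ℂ) - j + 1) * f (j - 1) z + 2 * Complex.I * deriv (f j) z)) ∧
    (∀ l : ℕ, ∃ G : ℕ → ℂ → ℂ,
      (∀ j, MeromorphicOn (G j) {z : ℂ | 0 < z.im}) ∧
      (∀ z : ℂ, 0 < z.im → (∀ j, AnalyticAt ℂ (f j) z) →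
        raiseIter l κ (fun w => ∑ j ∈ range (r + 1), ((w.im : ℂ)) ^ (-(j : ℤ)) * f j w) z
          = ∑ j ∈ range (r + l + 1), ((z.im : ℂ)) ^ (-(j : ℤ)) * G j z ∧
        G 0 z = (2 * Complex.I) ^ l * iteratedDeriv l (f 0) z)) := by
  exact ⟨fun z hz h => raiseOp_sum hz fun j _ => (h j).differentiableAt, fun l =>
    ⟨raiseIterCoeff κ r f l, meromorphicOn_raiseIterCoeff hf l, fun z hz h =>
      ⟨raiseIter_sum l hz fun j _ => h j, congrFun (raiseIterCoeff_zero κ r f l) z⟩⟩⟩
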